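/- Let u, v : ℝ × ℝ → ℝ be smooth functions of (x,t) solving the generalized Riemann equation at N=2, i.e. u_t = 2u·u_x − 2v and v_t = 2u·v_x, with v_x nowhere zero. Fix n ≥ 1 and let G : ℝ^{2n−1} → ℝ be any smooth function. Then the function F = (v_x/2)·G(α₁, α₂, β₂, …, α_n, β_n) satisfies the conservation law ∂_t F = ∂_x(2u·F) at every point. -/

import Mathlib

/-- Partial derivative with respect to the first variable `x`. -/
noncomputable def pdx (f : ℝ × ℝ → ℝ) (p : ℝ × ℝ) : ℝ := deriv (fun x => f (x, p.2)) p.1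

/-- Partial derivative with respect to the second variable `t`. -/
noncomputable def pdt (f : ℝ × ℝ → ℝ) (p : ℝ × ℝ) : ℝ := deriv (fun t => f (p.1, t)) p.2

theorem hasDerivAt_pdx {f : ℝ × ℝ → ℝ} {p : ℝ × ℝ} (hf : DifferentiableAt ℝ f p) :
    HasDerivAt (fun x => f (x, p.2)) (pdx f p) p.1 := by
  have h : DifferentiableAt ℝ (fun x : ℝ => f (x, p.2)) p.1 :=
    DifferentiableAt.comp (g := f) p.1 hf (by fun_prop)
  exact h.hasDerivAt

theorem hasDerivAt_pdt {f : ℝ × ℝ → ℝ} {p : ℝ × ℝ} (hf : DifferentiableAt ℝ f p) :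
    HasDerivAt (fun t => f (p.1, t)) (pdt f p) p.2 := by
  have h : DifferentiableAt ℝ (fun t : ℝ => f (p.1, t)) p.2 :=
    DifferentiableAt.comp (g := f) p.2 hf (by fun_prop)
  exact h.hasDerivAt

theorem pdx_eq_fderiv {f : ℝ × ℝ → ℝ} {p : ℝ × ℝ} (hf : DifferentiableAt ℝ f p) :
    pdx f p = fderiv ℝ f p (1, 0) := by
  have hg : HasDerivAt (fun x : ℝ => (x, p.2)) ((1 : ℝ), (0 : ℝ)) p.1 :=
    (hasDerivAt_id p.1).prodMk (hasDerivAt_const p.1 p.2)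
  exact (HasFDerivAt.comp_hasDerivAt (l := f) p.1 hf.hasFDerivAt hg).deriv

theorem pdt_eq_fderiv {f : ℝ × ℝ → ℝ} {p : ℝ × ℝ} (hf : DifferentiableAt ℝ f p) :
    pdt f p = fderiv ℝ f p (0, 1) := by
  have hg : HasDerivAt (fun t : ℝ => (p.1, t)) ((0 : ℝ), (1 : ℝ)) p.2 :=
    (hasDerivAt_const p.2 p.1).prodMk (hasDerivAt_id p.2)
  exact (HasFDerivAt.comp_hasDerivAt (l := f) p.2 hf.hasFDerivAt hg).deriv

theorem contDiff_pdx {f : ℝ × ℝ → ℝ} (hf : ContDiff ℝ (⊤ : ℕ∞) f) :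
    ContDiff ℝ (⊤ : ℕ∞) (pdx f) := by
  have hd : Differentiable ℝ f := hf.differentiable (by simp)
  have h : pdx f = fun p => fderiv ℝ f p (1, 0) := funext fun p => pdx_eq_fderiv (hd p)
  rw [h]
  exact (hf.fderiv_right (m := (⊤ : ℕ∞)) (by simp)).clm_apply contDiff_const

/-- Mixed partial derivatives of a smooth function commute. -/
theorem pdt_pdx_comm {f : ℝ × ℝ → ℝ} (hf : ContDiff ℝ (⊤ : ℕ∞) f) (p : ℝ × ℝ) :
    pdt (pdx f) p = pdx (pdt f) p := by
  have hd : Differentiable ℝ f := hf.differentiable (by simp)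
  have hx : pdx f = fun p => fderiv ℝ f p (1, 0) := funext fun p => pdx_eq_fderiv (hd p)
  have ht : pdt f = fun p => fderiv ℝ f p (0, 1) := funext fun p => pdt_eq_fderiv (hd p)
  have hd2 : DifferentiableAt ℝ (fderiv ℝ f) p :=
    (hf.fderiv_right (m := (⊤ : ℕ∞)) (by simp)).differentiable (by simp) p
  have happ (w : ℝ × ℝ) : HasFDerivAt (fun q => fderiv ℝ f q w)
      ((fderiv ℝ (fderiv ℝ f) p).flip w) p := by
    simpa using hd2.hasFDerivAt.clm_apply (hasFDerivAt_const w p)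
  rw [hx, ht, pdt_eq_fderiv (happ _).differentiableAt, pdx_eq_fderiv (happ _).differentiableAt,
    (happ _).fderiv, (happ _).fderiv]
  exact (hf.contDiffAt.isSymmSndFDerivAt (by
    rw [minSmoothness_of_isRCLikeNormedField]
    exact WithTop.coe_le_coe.2 (le_top (a := (2 : ℕ∞))))).eq _ _

/-- If `w_t = 2 u w_x + c` with `c` depending on `x` and `t`, then `w_x` satisfies the
differentiated equation. -/
theorem pdt_pdx_of_transport {u w c : ℝ × ℝ → ℝ} (hu : ContDiff ℝ (⊤ : ℕ∞) u)
    (hw : ContDiff ℝ (⊤ : ℕ∞) w) (hc : ContDiff ℝ (⊤ : ℕ∞) c)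
    (h : ∀ p, pdt w p = 2 * u p * pdx w p + c p) (p : ℝ × ℝ) :
    pdt (pdx w) p = 2 * u p * pdx (pdx w) p + 2 * pdx u p * pdx w p + pdx c p := by
  have hu' := hasDerivAt_pdx (hu.differentiable (by simp) p)
  have hw' := hasDerivAt_pdx ((contDiff_pdx hw).differentiable (by simp) p)
  have hc' := hasDerivAt_pdx (hc.differentiable (by simp) p)
  rw [pdt_pdx_comm hw, funext h]
  refine ((((hu'.const_mul 2).mul hw').add hc').deriv).trans ?_
  ring

/-- The operator `v_x⁻¹ ∂_x` maps solutions of `w_t = 2 u w_x + c`, `c` constant, to solutions of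
the homogeneous equation. -/
theorem pdt_inv_mul_pdx_of_transport {u v w : ℝ × ℝ → ℝ} (hu : ContDiff ℝ (⊤ : ℕ∞) u)
    (hv : ContDiff ℝ (⊤ : ℕ∞) v) (hw : ContDiff ℝ (⊤ : ℕ∞) w)
    (heqv : ∀ p, pdt v p = 2 * u p * pdx v p) (hvx : ∀ p, pdx v p ≠ 0) {c : ℝ}
    (h : ∀ p, pdt w p = 2 * u p * pdx w p + c) (p : ℝ × ℝ) :
    pdt (fun q => (pdx v q)⁻¹ * pdx w q) p
      = 2 * u p * pdx (fun q => (pdx v q)⁻¹ * pdx w q) p := by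
  have hc : pdx (fun _ => c) p = 0 := deriv_const _ _
  have hz : pdx (fun _ => (0 : ℝ)) p = 0 := deriv_const _ _
  have hDw := pdt_pdx_of_transport hu hw (c := fun _ => c) contDiff_const h p
  have hDv := pdt_pdx_of_transport hu hv (c := fun _ => 0) contDiff_const
    (fun p => by rw [heqv, add_zero]) p
  have dv := (contDiff_pdx hv).differentiable (by simp) p
  have dw := (contDiff_pdx hw).differentiable (by simp) p
  have ht : pdt (fun q => (pdx v q)⁻¹ * pdx w q) p = _ :=
    (((hasDerivAt_pdt dv).inv (hvx p)).mul (hasDerivAt_pdt dw)).deriv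
  have hx : pdx (fun q => (pdx v q)⁻¹ * pdx w q) p = _ :=
    (((hasDerivAt_pdx dv).inv (hvx p)).mul (hasDerivAt_pdx dw)).deriv
  have := hvx p
  rw [ht, hx, hDv, hDw, hc, hz]
  simp only [Pi.inv_apply, Prod.mk.eta]
  field_simp
  ring

/-- Iterating `v_x⁻¹ ∂_x` on a smooth solution of `w_t = 2 u w_x + c`, `c` constant, yields smooth
solutions of the homogeneous equation. -/
theorem transport_of_recursion {u v : ℝ × ℝ → ℝ} (hu : ContDiff ℝ (⊤ : ℕ∞) u)
    (hv : ContDiff ℝ (⊤ : ℕ∞) v) (heqv : ∀ p, pdt v p = 2 * u p * pdx v p)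
    (hvx : ∀ p, pdx v p ≠ 0) {w : ℕ → ℝ × ℝ → ℝ} {c : ℝ} (hw : ContDiff ℝ (⊤ : ℕ∞) (w 1))
    (h : ∀ p, pdt (w 1) p = 2 * u p * pdx (w 1) p + c)
    (hrec : ∀ k, 1 ≤ k → ∀ p, w (k + 1) p = (pdx v p)⁻¹ * pdx (w k) p) (k : ℕ) :
    ContDiff ℝ (⊤ : ℕ∞) (w (k + 2)) ∧
      ∀ p, pdt (w (k + 2)) p = 2 * u p * pdx (w (k + 2)) p := by
  induction k with
  | zero =>
    rw [funext (hrec 1 le_rfl)]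
    exact ⟨((contDiff_pdx hv).inv hvx).mul (contDiff_pdx hw),
      pdt_inv_mul_pdx_of_transport hu hv hw heqv hvx h⟩
  | succ k ih =>
    rw [funext (hrec (k + 2) (by omega))]
    exact ⟨((contDiff_pdx hv).inv hvx).mul (contDiff_pdx ih.1),
      pdt_inv_mul_pdx_of_transport hu hv ih.1 heqv hvx (c := 0)
        fun p => by rw [ih.2, add_zero]⟩

/-- A smooth function of solutions of `w_t = 2 u w_x` is again a solution. -/
theorem pdt_comp_of_transport {ι : Type*} [Fintype ι] {u : ℝ × ℝ → ℝ} {G : (ι → ℝ) → ℝ}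
    {a : ℝ × ℝ → ι → ℝ} {p : ℝ × ℝ} (hG : DifferentiableAt ℝ G (a p))
    (ha : ∀ i, DifferentiableAt ℝ (fun q => a q i) p)
    (h : ∀ i, pdt (fun q => a q i) p = 2 * u p * pdx (fun q => a q i) p) :
    pdt (fun q => G (a q)) p = 2 * u p * pdx (fun q => G (a q)) p := by
  have ht : pdt (fun q => G (a q)) p = fderiv ℝ G (a p) (fun i => pdt (fun q => a q i) p) :=
    (HasFDerivAt.comp_hasDerivAt (l := G) (f := fun t => a (p.1, t)) p.2 hG.hasFDerivAt
      (hasDerivAt_pi.2 fun i => hasDerivAt_pdt (ha i))).deriv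
  have hx : pdx (fun q => G (a q)) p = fderiv ℝ G (a p) (fun i => pdx (fun q => a q i) p) :=
    (HasFDerivAt.comp_hasDerivAt (l := G) (f := fun x => a (x, p.2)) p.1 hG.hasFDerivAt
      (hasDerivAt_pi.2 fun i => hasDerivAt_pdx (ha i))).deriv
  have hs : (fun i => pdt (fun q => a q i) p) = (2 * u p) • fun i => pdx (fun q => a q i) p := by
    ext i
    simp [h i]
  rw [ht, hx, hs, map_smul, smul_eq_mul]

theorem riemannN2_conserved_density (u v : ℝ × ℝ → ℝ)
    (hu : ContDiff ℝ (⊤ : ℕ∞) u) (hv : ContDiff ℝ (⊤ : ℕ∞) v)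
    (hequ : ∀ p : ℝ × ℝ, pdt u p = 2 * u p * pdx u p - 2 * v p)
    (heqv : ∀ p : ℝ × ℝ, pdt v p = 2 * u p * pdx v p)
    (hvx : ∀ p : ℝ × ℝ, pdx v p ≠ 0)
    (n : ℕ) (hn : 1 ≤ n)
    (G : (Fin (2 * n - 1) → ℝ) → ℝ) (hG : ContDiff ℝ (⊤ : ℕ∞) G)
    (α β : ℕ → ℝ × ℝ → ℝ)
    (hα1 : ∀ p : ℝ × ℝ, α 1 p = (pdx u p) ^ 2 * ((pdx v p) ^ 2)⁻¹ - 2 * (pdx v p)⁻¹)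
    (hβ1 : ∀ p : ℝ × ℝ, β 1 p = pdx u p * (pdx v p)⁻¹)
    (hαrec : ∀ k, 1 ≤ k → ∀ p : ℝ × ℝ, α (k + 1) p = (pdx v p)⁻¹ * pdx (α k) p)
    (hβrec : ∀ k, 1 ≤ k → ∀ p : ℝ × ℝ, β (k + 1) p = (pdx v p)⁻¹ * pdx (β k) p) :
    ∀ p : ℝ × ℝ,
      pdt (fun q => pdx v q / 2 *
      G (fun i => if i.val = 0 then α 1 q
          else if i.val % 2 = 1 then α (i.val / 2 + 2) q
          else β (i.val / 2 + 1) q)) p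
        = pdx (fun q => 2 * u q * ((fun q => pdx v q / 2 *
      G (fun i => if i.val = 0 then α 1 q
          else if i.val % 2 = 1 then α (i.val / 2 + 2) q
          else β (i.val / 2 + 1) q)) q)) p := by
  have cu := contDiff_pdx hu
  have cv := contDiff_pdx hv
  have du (p) := cu.differentiable (by simp) p
  have dv (p) := cv.differentiable (by simp) p
  have hDu (p) := pdt_pdx_of_transport hu hu (c := fun p => -(2 * v p))
    (contDiff_const.mul hv).neg (fun p => by rw [hequ]; ring) p
  have hDv (p) := pdt_pdx_of_transport hu hv (c := fun _ => 0) contDiff_const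
    (fun p => by rw [heqv, add_zero]) p
  have hvc (p) : pdx (fun p => -(2 * v p)) p = -(2 * pdx v p) :=
    ((hasDerivAt_pdx (hv.differentiable (by simp) p)).const_mul 2).neg.deriv
  have hz (p) : pdx (fun _ => (0 : ℝ)) p = 0 := deriv_const _ _
  simp only [hvc] at hDu
  simp only [hz, add_zero] at hDv
  have hβs : ContDiff ℝ (⊤ : ℕ∞) (β 1) := by
    rw [funext hβ1]
    exact cu.mul (cv.inv hvx)
  have hβt (p) : pdt (β 1) p = 2 * u p * pdx (β 1) p + (-2) := by
    have := hvx p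
    have ht : pdt (fun q => pdx u q * (pdx v q)⁻¹) p = _ :=
      ((hasDerivAt_pdt (du p)).mul ((hasDerivAt_pdt (dv p)).inv (hvx p))).deriv
    have hx : pdx (fun q => pdx u q * (pdx v q)⁻¹) p = _ :=
      ((hasDerivAt_pdx (du p)).mul ((hasDerivAt_pdx (dv p)).inv (hvx p))).deriv
    rw [funext hβ1, ht, hx, hDu, hDv]
    simp only [Pi.inv_apply, Prod.mk.eta]
    field_simp
    ring
  have hα1' : α 1 = fun p => β 1 p ^ 2 - 2 * (pdx v p)⁻¹ := by
    funext p
    rw [hα1, hβ1, mul_pow, inv_pow]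
  have hαs : ContDiff ℝ (⊤ : ℕ∞) (α 1) := by
    rw [hα1']
    exact (hβs.pow 2).sub (contDiff_const.mul (cv.inv hvx))
  have hαt (p) : pdt (α 1) p = 2 * u p * pdx (α 1) p := by
    have := hvx p
    have db := hβs.differentiable (by simp) p
    have ht : pdt (fun p => β 1 p ^ 2 - 2 * (pdx v p)⁻¹) p = _ :=
      (((hasDerivAt_pdt db).pow 2).sub
        (((hasDerivAt_pdt (dv p)).inv (hvx p)).const_mul 2)).deriv
    have hx : pdx (fun p => β 1 p ^ 2 - 2 * (pdx v p)⁻¹) p = _ :=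
      (((hasDerivAt_pdx db).pow 2).sub
        (((hasDerivAt_pdx (dv p)).inv (hvx p)).const_mul 2)).deriv
    rw [hα1', ht, hx, hβt, hDv]
    simp only [Prod.mk.eta, hβ1, Nat.reduceSub, pow_one, Nat.cast_ofNat]
    field_simp
    ring
  have hα := transport_of_recursion hu hv heqv hvx (c := 0) hαs
    (fun p => by rw [hαt, add_zero]) hαrec
  have hβ := transport_of_recursion hu hv heqv hvx hβs hβt hβrec
  intro p
  set a : ℝ × ℝ → Fin (2 * n - 1) → ℝ := fun q i => if i.val = 0 then α 1 q
    else if i.val % 2 = 1 then α (i.val / 2 + 2) q else β (i.val / 2 + 1) q with ha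
  have hai (i) : ContDiff ℝ (⊤ : ℕ∞) (fun q => a q i) ∧
      ∀ p, pdt (fun q => a q i) p = 2 * u p * pdx (fun q => a q i) p := by
    by_cases h0 : i.val = 0
    · simp only [ha, h0, if_true]
      exact ⟨hαs, hαt⟩
    by_cases h1 : i.val % 2 = 1
    · simp only [ha, h0, h1, if_true, if_false]
      exact hα _
    · obtain ⟨k, hk⟩ : ∃ k, i.val / 2 + 1 = k + 2 := ⟨i.val / 2 - 1, by omega⟩
      simp only [ha, h0, h1, if_false, hk]
      exact hβ k
  have hGt := pdt_comp_of_transport (u := u) (a := a) (hG.differentiable (by simp) (a p))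
    (fun i => (hai i).1.differentiable (by simp) p) (fun i => (hai i).2 p)
  have dG : DifferentiableAt ℝ (fun q => G (a q)) p :=
    (hG.comp (contDiff_pi.2 fun i => (hai i).1)).differentiable (by simp) p
  have ht : pdt (fun q => pdx v q / 2 * G (a q)) p = _ :=
    (((hasDerivAt_pdt (dv p)).div_const 2).mul (hasDerivAt_pdt dG)).deriv
  have hx : pdx (fun q => 2 * u q * (pdx v q / 2 * G (a q))) p = _ :=
    (((hasDerivAt_pdx (hu.differentiable (by simp) p)).const_mul 2).mul
      (((hasDerivAt_pdx (dv p)).div_const 2).mul (hasDerivAt_pdx dG))).deriv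
  refine ht.trans (Eq.trans ?_ hx.symm)
  simp only [Pi.mul_apply, Prod.mk.eta]
  rw [hGt, hDv]
  ring
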